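/- arXiv:2605.17257 — 5 statements merged into one kernel-verified Lean document; each statement's English description precedes it below -/
import Mathlib

section
/- Suppose we are given groups K, G, H, G̃, H̃ together with homomorphisms ĩ : K → G̃, j̃ : G̃ → H̃, i : K → G, j : G → H, vertical homomorphisms p| : K → K, p : G̃ → G, p̄ : H̃ → H, and further vertical homomorphisms f| : K → K, f : G → G, f̄ : H → H, such that: (1) both sequences 1 → K → G̃ → H̃ → 1 (via ĩ, j̃) and 1 → K → G → H → 1 (via i, j) are exact (ĩ and i are injective, j̃ and j are surjective, ker j̃ = im ĩ and ker j = im i); (2) the diagram commutes, i.e. p ∘ ĩ = i ∘ (p|), p̄ ∘ j̃ = j ∘ p, f ∘ i = i ∘ (f|), and f̄ ∘ j = j ∘ f; (3) p| : K → K is surjective; and (4) f̄(im p̄) ⊆ im p̄. Then f(im p) ⊆ im p. -/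
/-- **Lemma 4.1 (map lifting, algebraic form).**
Given a commutative diagram of groups with exact rows
`1 → K → G̃ → H̃ → 1` and `1 → K → G → H → 1`, vertical maps
`p| : K → K`, `p : G̃ → G`, `p̄ : H̃ → H` and `f| : K → K`, `f : G → G`,
`f̄ : H → H`, such that `p|` is surjective and `f̄(im p̄) ⊆ im p̄`,
we have `f(im p) ⊆ im p`. -/
theorem map_lifting_algebraic
    {K G H Gt Ht : Type*} [Group K] [Group G] [Group H] [Group Gt] [Group Ht]
    (it : K →* Gt) (jt : Gt →* Ht)
    (i : K →* G) (j : G →* H)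
    (pK : K →* K) (p : Gt →* G) (pb : Ht →* H)
    (fK : K →* K) (f : G →* G) (fb : H →* H)
    -- (1) exactness of the two rows
    (hit_inj : Function.Injective it) (hjt_surj : Function.Surjective jt)
    (hexact_t : jt.ker = it.range)
    (hi_inj : Function.Injective i) (hj_surj : Function.Surjective j)
    (hexact : j.ker = i.range)
    -- (2) commutativity of the diagram
    (hcomm1 : p.comp it = i.comp pK)
    (hcomm2 : pb.comp jt = j.comp p)
    (hcomm3 : f.comp i = i.comp fK)
    (hcomm4 : fb.comp j = j.comp f)
    -- (3) `p| : K → K` is surjective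
    (hpK_surj : Function.Surjective pK)
    -- (4) `f̄(im p̄) ⊆ im p̄`
    (hfb : ∀ x ∈ pb.range, fb x ∈ pb.range) :
    ∀ x ∈ p.range, f x ∈ p.range := by
  rintro _ ⟨g, rfl⟩
  obtain ⟨y, hy⟩ := hfb (pb (jt g)) ⟨jt g, rfl⟩
  obtain ⟨g', rfl⟩ := hjt_surj y
  have hj : j (f (p g)) = j (p g') := by
    have h2 := DFunLike.congr_fun hcomm2
    have h4 := DFunLike.congr_fun hcomm4 (p g)
    simp only [MonoidHom.comp_apply] at h2 h4
    rw [← h4, ← h2, ← h2, hy]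
  have hker : (p g')⁻¹ * f (p g) ∈ j.ker := by
    simp [MonoidHom.mem_ker, hj]
  rw [hexact] at hker
  obtain ⟨k, hk⟩ := hker
  obtain ⟨k', rfl⟩ := hpK_surj k
  have h1 : p (it k') = i (pK k') := DFunLike.congr_fun hcomm1 k'
  exact ⟨g' * it k', by rw [map_mul, h1, hk, mul_inv_cancel_left]⟩
end

section
/- Let E = EuclideanSpace ℝ (Fin 3) and let Γ be a subgroup of the group of affine isometry equivalences of E. Suppose the set P = {linear part of γ : γ ∈ Γ} is finite, of cardinality n. Then there exists a point c ∈ E such that for every γ ∈ Γ, the vector n • (γ(c) − c) belongs to T(Γ). (Equivalently: after conjugating Γ by a translation, the orbit Γ·0 is contained in (1/n)·T(Γ).) -/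
namespace AffineIsometryEquiv

variable {V : Type*} [NormedAddCommGroup V] [NormedSpace ℝ V]

theorem apply_eq_linearIsometryEquiv_add (γ : V ≃ᵃⁱ[ℝ] V) (x : V) :
    γ x = γ.linearIsometryEquiv x + γ 0 := by
  simpa using γ.map_vadd 0 x

theorem linearIsometryEquiv_mul (γ δ : V ≃ᵃⁱ[ℝ] V) :
    (γ * δ).linearIsometryEquiv = γ.linearIsometryEquiv * δ.linearIsometryEquiv := rfl

/-- The additive subgroup of vectors whose translation belongs to `Γ`. -/
def translationSubgroup (Γ : Subgroup (V ≃ᵃⁱ[ℝ] V)) : AddSubgroup V where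
  carrier := {v | constVAdd ℝ V v ∈ Γ}
  zero_mem' := by
    rw [Set.mem_ofPred_eq, constVAdd_zero]
    exact Γ.one_mem
  add_mem' {v w} hv hw := by
    have h : constVAdd ℝ V (v + w) = constVAdd ℝ V v * constVAdd ℝ V w := by
      ext x
      simp [add_assoc]
    simpa only [Set.mem_ofPred_eq, h] using Γ.mul_mem hv hw
  neg_mem' {v} hv := by
    have h : constVAdd ℝ V (-v) = (constVAdd ℝ V v)⁻¹ := by
      rw [eq_inv_iff_mul_eq_one]
      ext x
      simp
    simpa only [Set.mem_ofPred_eq, h] using Γ.inv_mem hv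

theorem mem_translationSubgroup {Γ : Subgroup (V ≃ᵃⁱ[ℝ] V)} {v : V} :
    v ∈ translationSubgroup Γ ↔ constVAdd ℝ V v ∈ Γ := Iff.rfl

theorem sub_mem_translationSubgroup {Γ : Subgroup (V ≃ᵃⁱ[ℝ] V)} {γ δ : V ≃ᵃⁱ[ℝ] V}
    (hγ : γ ∈ Γ) (hδ : δ ∈ Γ) (h : γ.linearIsometryEquiv = δ.linearIsometryEquiv) :
    γ 0 - δ 0 ∈ translationSubgroup Γ := by
  have key : constVAdd ℝ V (γ 0 - δ 0) = γ * δ⁻¹ := by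
    rw [eq_mul_inv_iff_mul_eq]
    ext x
    simp only [coe_mul, coe_constVAdd, Function.comp_apply, vadd_eq_add]
    rw [apply_eq_linearIsometryEquiv_add δ x, apply_eq_linearIsometryEquiv_add γ x, h]
    abel
  rw [mem_translationSubgroup, key]
  exact Γ.mul_mem hγ (Γ.inv_mem hδ)

/-- If the group of linear parts of `Γ` is finite of order `n`, then the barycenter `c` of the
images of the origin under representatives of the linear parts satisfies
`n • (γ c - c) ∈ translationSubgroup Γ` for every `γ ∈ Γ`. -/
theorem exists_nsmul_sub_mem_translationSubgroup (Γ : Subgroup (V ≃ᵃⁱ[ℝ] V))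
    (hfin : {A : V ≃ₗᵢ[ℝ] V | ∃ γ ∈ Γ, γ.linearIsometryEquiv = A}.Finite) :
    ∃ c : V, ∀ γ ∈ Γ,
      {A : V ≃ₗᵢ[ℝ] V | ∃ γ ∈ Γ, γ.linearIsometryEquiv = A}.ncard • (γ c - c) ∈
        translationSubgroup Γ := by
  set P : Set (V ≃ₗᵢ[ℝ] V) := {A | ∃ γ ∈ Γ, γ.linearIsometryEquiv = A}
  have : Fintype P := hfin.fintype
  choose s hsΓ hs using fun A : P => A.2
  have hcard : P.ncard = Fintype.card P := by
    rw [← Nat.card_coe_set_eq, Nat.card_eq_fintype_card]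
  have hne : (P.ncard : ℝ) ≠ 0 := by
    have : Nonempty P := ⟨⟨_, 1, Γ.one_mem, rfl⟩⟩
    rw [hcard]
    exact_mod_cast Fintype.card_ne_zero
  set c : V := (P.ncard : ℝ)⁻¹ • ∑ A, s A 0 with hc
  have hnc : P.ncard • c = ∑ A, s A 0 := by
    rw [← Nat.cast_smul_eq_nsmul ℝ, hc, smul_inv_smul₀ hne]
  refine ⟨c, fun γ hγ => ?_⟩
  have hmem (B : P) : γ.linearIsometryEquiv * B.1 ∈ P := by
    rw [← hs B, ← linearIsometryEquiv_mul]
    exact ⟨_, Γ.mul_mem hγ (hsΓ B), rfl⟩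
  let f : P → P := fun B => ⟨γ.linearIsometryEquiv * B.1, hmem B⟩
  have hf : Function.Bijective f := Finite.injective_iff_bijective.mp fun B C h =>
    Subtype.ext (mul_left_cancel (congrArg Subtype.val h))
  have hsum : P.ncard • (γ c - c) = ∑ B, ((γ * s B) 0 - s (f B) 0) := by
    rw [Finset.sum_sub_distrib, hf.sum_comp (fun B => s B 0), smul_sub, hnc,
      apply_eq_linearIsometryEquiv_add γ c, smul_add, ← map_nsmul, hnc, map_sum]
    simp only [coe_mul, Function.comp_apply, apply_eq_linearIsometryEquiv_add γ (s _ 0),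
      Finset.sum_add_distrib, Finset.sum_const, Finset.card_univ, hcard]
  rw [hsum]
  refine sum_mem fun B _ => sub_mem_translationSubgroup (Γ.mul_mem hγ (hsΓ B)) (hsΓ _) ?_
  rw [linearIsometryEquiv_mul, hs, hs]

end AffineIsometryEquiv

/-- **The Claim in Case 3 of Proposition 5.2 (Bieberbach-type averaging).**
Let `Γ` be a subgroup of the group of affine isometry equivalences of
`E = 𝔼³` whose set `P` of linear parts is finite, of cardinality `n`.  Then
there is a point `c ∈ E` such that for every `γ ∈ Γ` the vector
`n • (γ c - c)` lies in the translation subgroup `T(Γ)`, i.e. the translation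
by `n • (γ c - c)` belongs to `Γ`.  (Equivalently, after conjugating `Γ` by a
translation, `Γ · 0 ⊆ (1/n) T(Γ)`.) -/
theorem orbit_of_center_in_fractional_lattice
    (Γ : Subgroup (EuclideanSpace ℝ (Fin 3) ≃ᵃⁱ[ℝ] EuclideanSpace ℝ (Fin 3)))
    (P : Set (EuclideanSpace ℝ (Fin 3) ≃ₗᵢ[ℝ] EuclideanSpace ℝ (Fin 3)))
    (hP : P = {A | ∃ γ ∈ Γ, AffineIsometryEquiv.linearIsometryEquiv γ = A})
    (hPfin : P.Finite) (n : ℕ) (hn : P.ncard = n) :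
    ∃ c : EuclideanSpace ℝ (Fin 3), ∀ γ ∈ Γ,
      AffineIsometryEquiv.constVAdd ℝ (EuclideanSpace ℝ (Fin 3))
        (n • ((γ : EuclideanSpace ℝ (Fin 3) ≃ᵃⁱ[ℝ] EuclideanSpace ℝ (Fin 3)) c - c)) ∈ Γ := by
  subst hP hn
  exact AffineIsometryEquiv.exists_nsmul_sub_mem_translationSubgroup Γ hPfin
end

section
/- Let E = EuclideanSpace ℝ (Fin 3), let Γ be a subgroup of the group of affine isometry equivalences of E, and let n be a positive integer such that for every γ ∈ Γ, the vector n • γ(0) belongs to T(Γ). Then for every natural number k, the dilation μ_k : E → E defined by μ_k(v) = (n·k + 1) • v satisfies: for every γ ∈ Γ there exists γ′ ∈ Γ with μ_k ∘ γ = γ′ ∘ μ_k as maps E → E. -/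
theorem AffineIsometryEquiv.map_eq_linearIsometryEquiv_add {𝕜 V W : Type*} [NormedField 𝕜]
    [SeminormedAddCommGroup V] [NormedSpace 𝕜 V] [SeminormedAddCommGroup W] [NormedSpace 𝕜 W]
    (γ : V ≃ᵃⁱ[𝕜] W) (v : V) : γ v = γ.linearIsometryEquiv v + γ 0 := by
  simpa using γ.map_vadd 0 v

theorem AffineIsometryEquiv.constVAdd_pow_apply {𝕜 V : Type*} [NormedField 𝕜]
    [SeminormedAddCommGroup V] [NormedSpace 𝕜 V] (b v : V) (k : ℕ) :
    (AffineIsometryEquiv.constVAdd 𝕜 V b ^ k) v = k • b + v := by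
  induction k with
  | zero => simp
  | succ k ih =>
    rw [pow_succ', AffineIsometryEquiv.coe_mul, Function.comp_apply, ih,
      succ_nsmul', add_assoc]
    simp

/-- **Case 3 of Proposition 5.2: the dilation `μ_k` descends.**
Let `Γ` be a subgroup of the affine isometry group of `E = 𝔼³` and `n` a
positive integer such that for every `γ ∈ Γ` the translation by `n • γ(0)`
belongs to `Γ` (i.e. `Γ · 0 ⊆ (1/n) T(Γ)`).  Then for every `k`, the dilation
`μ_k(v) = (n·k + 1) • v` satisfies: for each `γ ∈ Γ` there is `γ' ∈ Γ` with
`μ_k ∘ γ = γ' ∘ μ_k`. -/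
theorem dilation_equivariant_of_orbit_in_fractional_lattice
    (Γ : Subgroup (EuclideanSpace ℝ (Fin 3) ≃ᵃⁱ[ℝ] EuclideanSpace ℝ (Fin 3)))
    (n : ℕ) (hn : 0 < n)
    (hΓ : ∀ γ ∈ Γ,
      AffineIsometryEquiv.constVAdd ℝ (EuclideanSpace ℝ (Fin 3))
        (n • ((γ : EuclideanSpace ℝ (Fin 3) ≃ᵃⁱ[ℝ] EuclideanSpace ℝ (Fin 3))
          (0 : EuclideanSpace ℝ (Fin 3)))) ∈ Γ) :
    ∀ k : ℕ, ∀ γ ∈ Γ, ∃ γ' ∈ Γ, ∀ v : EuclideanSpace ℝ (Fin 3),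
      ((n * k + 1 : ℕ) : ℝ) •
          ((γ : EuclideanSpace ℝ (Fin 3) ≃ᵃⁱ[ℝ] EuclideanSpace ℝ (Fin 3)) v) =
        (γ' : EuclideanSpace ℝ (Fin 3) ≃ᵃⁱ[ℝ] EuclideanSpace ℝ (Fin 3))
          (((n * k + 1 : ℕ) : ℝ) • v) := by
  intro k γ hγ
  refine ⟨_, Γ.mul_mem (Γ.pow_mem (hΓ γ hγ) k) hγ, fun v => ?_⟩
  rw [AffineIsometryEquiv.coe_mul, Function.comp_apply, AffineIsometryEquiv.constVAdd_pow_apply,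
    γ.map_eq_linearIsometryEquiv_add v, γ.map_eq_linearIsometryEquiv_add (_ • v), map_smul]
  simp only [← Nat.cast_smul_eq_nsmul ℝ]
  push_cast
  module
end

section
/- Let G be a group, ε : G → {±1} a group homomorphism (into the multiplicative group {1, −1}), and H a subgroup of G of finite index with H ⊆ ker ε. Let t : G → ℝ be a skew homomorphism with respect to ε, i.e. t(g·h) = ε(h)·t(g) + t(h) for all g, h ∈ G. Let k ≥ 2 be an integer and let ι : G → G be a group homomorphism such that ε ∘ ι = ε and ι(h) = h^k for every h ∈ H. If t(ι(g)) = k²·t(g) for all g ∈ G, then t is identically zero. -/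
/-- **Claim C in the proof of Proposition 5.3 (Nil geometry).**
Let `ε : G → {±1}` be a homomorphism, `H ≤ ker ε` a finite-index subgroup, and
`t : G → ℝ` a skew homomorphism with respect to `ε`, i.e.
`t (g·h) = ε(h)·t(g) + t(h)`.  Let `k ≥ 2` and let `ι : G → G` be a
homomorphism with `ε ∘ ι = ε` and `ι(h) = h^k` for all `h ∈ H`.  If
`t ∘ ι = k² · t`, then `t ≡ 0`.  (The linear map `t ↦ (1/k²)·t∘ι` on skew
homomorphisms has no eigenvalue `1`.) -/
theorem skew_homomorphism_eigenvalue_one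
    {G : Type*} [Group G] (ε : G →* ℤˣ) (H : Subgroup G)
    (hHfin : H.FiniteIndex) (hHker : H ≤ ε.ker)
    (t : G → ℝ)
    (hskew : ∀ g h : G, t (g * h) = ((ε h : ℤ) : ℝ) * t g + t h)
    (k : ℕ) (hk : 2 ≤ k) (ι : G →* G)
    (hει : ε.comp ι = ε) (hιH : ∀ h ∈ H, ι h = h ^ k)
    (ht : ∀ g : G, t (ι g) = (k : ℝ) ^ 2 * t g) :
    ∀ g : G, t g = 0 := by
  have t_pow : ∀ g : G, ε g = 1 → ∀ n : ℕ, t (g ^ n) = n * t g := by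
    intro g hg n
    induction n with
    | zero => simpa using hskew 1 1
    | succ n ih =>
      rw [pow_succ, hskew, hg, ih]
      push_cast
      ring
  have hk' : (2 : ℝ) ≤ k := by exact_mod_cast hk
  have t_H : ∀ h ∈ H, t h = 0 := by
    intro h hh
    have hth := ht h
    rw [hιH h hh, t_pow h (hHker hh)] at hth
    have hprod : ((k : ℝ) * (k - 1)) * t h = 0 := by linear_combination -hth
    exact (mul_eq_zero.mp hprod).resolve_left
      (mul_ne_zero (by linarith) (by linarith))
  have t_ker : ∀ g : G, ε g = 1 → t g = 0 := by
    intro g hg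
    obtain ⟨n, hn, -, hgn⟩ := H.exists_pow_mem_of_index_ne_zero hHfin.index_ne_zero g
    have htn := t_H _ hgn
    rw [t_pow g hg] at htn
    exact (mul_eq_zero.mp htn).resolve_left (by exact_mod_cast hn.ne')
  intro g
  have hε : ε (ι g * g⁻¹) = 1 := by
    rw [map_mul, map_inv, ← MonoidHom.comp_apply, hει, mul_inv_cancel]
  have hι : t (ι g) = t g := by
    simpa [t_ker _ hε] using hskew (ι g * g⁻¹) g
  have hprod : ((k : ℝ) ^ 2 - 1) * t g = 0 := by
    linear_combination hι - ht g
  exact (mul_eq_zero.mp hprod).resolve_left (by nlinarith)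
end

section
/- Let A be an element of SL(2, ℤ) with |trace A| > 2, let k be an integer, and let B be a 2×2 matrix with rational entries and nonzero determinant such that B·A = A^k·B (where A and its k-th power, taken in the group SL(2,ℤ) so that negative k is allowed, are regarded as rational matrices). Then k = 1 or k = −1. -/
section

open Matrix

theorem Matrix.trace_mul_mul_self_fin_two {R : Type*} [CommRing R]
    (M A : Matrix (Fin 2) (Fin 2) R) :
    trace (M * A * A) = trace A * trace (M * A) - A.det * trace M := by
  simp only [trace_fin_two, det_fin_two, mul_apply, Fin.sum_univ_two]
  ring

theorem Matrix.SpecialLinearGroup.trace_inv_fin_two {R : Type*} [CommRing R]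
    (A : SpecialLinearGroup (Fin 2) R) :
    trace (↑A⁻¹ : Matrix (Fin 2) (Fin 2) R) = trace (A : Matrix (Fin 2) (Fin 2) R) := by
  rw [SpecialLinearGroup.coe_inv, adjugate_fin_two, trace_fin_two, trace_fin_two]
  simp [add_comm]

theorem Matrix.SpecialLinearGroup.trace_zpow_natAbs_fin_two {R : Type*} [CommRing R]
    (A : SpecialLinearGroup (Fin 2) R) (k : ℤ) :
    trace (↑(A ^ k) : Matrix (Fin 2) (Fin 2) R) =
      trace (↑(A ^ k.natAbs) : Matrix (Fin 2) (Fin 2) R) := by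
  obtain hk | hk := Int.natAbs_eq k
  · conv_lhs => rw [hk, _root_.zpow_natCast]
  · conv_lhs => rw [hk, _root_.zpow_neg, _root_.zpow_natCast, trace_inv_fin_two]

theorem Matrix.SpecialLinearGroup.strictMono_abs_trace_pow
    (A : SpecialLinearGroup (Fin 2) ℤ) (hA : 2 < |trace (A : Matrix (Fin 2) (Fin 2) ℤ)|) :
    StrictMono fun n : ℕ => |trace (↑(A ^ n) : Matrix (Fin 2) (Fin 2) ℤ)| := by
  refine strictMono_nat_of_lt_succ fun n => ?_
  induction n with
  | zero => simpa using hA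
  | succ n ih =>
    have hrec : trace (↑(A ^ (n + 2)) : Matrix (Fin 2) (Fin 2) ℤ) =
        trace (A : Matrix (Fin 2) (Fin 2) ℤ) *
            trace (↑(A ^ (n + 1)) : Matrix (Fin 2) (Fin 2) ℤ) -
          trace (↑(A ^ n) : Matrix (Fin 2) (Fin 2) ℤ) := by
      have := trace_mul_mul_self_fin_two (↑(A ^ n) : Matrix (Fin 2) (Fin 2) ℤ) A
      rw [A.det_coe, one_mul] at this
      simpa only [pow_succ, SpecialLinearGroup.coe_mul] using this
    have hsub := abs_sub_abs_le_abs_sub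
      (trace (A : Matrix (Fin 2) (Fin 2) ℤ) *
        trace (↑(A ^ (n + 1)) : Matrix (Fin 2) (Fin 2) ℤ))
      (trace (↑(A ^ n) : Matrix (Fin 2) (Fin 2) ℤ))
    rw [← hrec, abs_mul] at hsub
    have := abs_nonneg (trace (↑(A ^ (n + 1)) : Matrix (Fin 2) (Fin 2) ℤ))
    rw [show n + 1 + 1 = n + 2 from rfl]
    nlinarith

theorem Matrix.trace_eq_of_mul_eq_mul {n R : Type*} [Fintype n] [DecidableEq n] [CommRing R]
    {B M N : Matrix n n R} (hB : IsUnit B.det) (h : B * M = N * B) : trace M = trace N := by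
  rw [← nonsing_inv_mul_cancel_left (A := B) M hB, h, trace_mul_comm,
    mul_nonsing_inv_cancel_right _ _ hB]

end

/-- **The key algebraic step in Lemma 5.6 (Sol torus bundles).**
Let `A ∈ SL(2, ℤ)` with `|trace A| > 2`, let `k ∈ ℤ`, and let `B` be a `2×2`
rational matrix with nonzero determinant such that `B·A = A^k·B` (as rational
matrices).  Then `k = 1` or `k = -1`. -/
theorem sl2_conjugate_power_hyperbolic
    (A : Matrix.SpecialLinearGroup (Fin 2) ℤ)
    (htr : |Matrix.trace (A : Matrix (Fin 2) (Fin 2) ℤ)| > 2)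
    (k : ℤ) (B : Matrix (Fin 2) (Fin 2) ℚ) (hB : B.det ≠ 0)
    (h : B * ((A : Matrix (Fin 2) (Fin 2) ℤ).map (Int.cast : ℤ → ℚ)) =
      (((A ^ k : Matrix.SpecialLinearGroup (Fin 2) ℤ) :
        Matrix (Fin 2) (Fin 2) ℤ).map (Int.cast : ℤ → ℚ)) * B) :
    k = 1 ∨ k = -1 := by
  have htrace := Matrix.trace_eq_of_mul_eq_mul hB.isUnit h
  simp only [Matrix.trace_fin_two, Matrix.map_apply] at htrace
  norm_cast at htrace
  rw [← Matrix.trace_fin_two, ← Matrix.trace_fin_two,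
    Matrix.SpecialLinearGroup.trace_zpow_natAbs_fin_two] at htrace
  have hk : 1 = k.natAbs := (A.strictMono_abs_trace_pow htr).injective (by simp [htrace])
  exact Int.natAbs_eq_iff.mp hk.symm
end
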